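/- Let R be a regular incline. Then R, partially ordered by the incline order, is a distributive lattice in which for all x, y the join of x and y is x + y and the meet of x and y is x*y. -/

import Mathlib

/-- An incline: a nonempty set with `+` and `*` such that `(R,+)` is a commutative
semigroup, `(R,*)` is a semigroup, `*` distributes over `+` from both sides,
addition is idempotent, and `x + x*y = x`, `x + y*x = x` for all `x y`.
(Nonemptiness is assumed via `Nonempty R` where needed.) -/
class Incline (R : Type*) extends Add R, Mul R where
  add_comm : ∀ x y : R, x + y = y + x
  add_assoc : ∀ x y z : R, x + y + z = x + (y + z)
  mul_assoc : ∀ x y z : R, x * y * z = x * (y * z)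
  left_distrib : ∀ x y z : R, x * (y + z) = x * y + x * z
  right_distrib : ∀ x y z : R, (x + y) * z = x * z + y * z
  add_idem : ∀ x : R, x + x = x
  add_absorb_mul_left : ∀ x y : R, x + x * y = x
  add_absorb_mul_right : ∀ x y : R, x + y * x = x

/-- An element `a` of an incline is regular if `a * z * a = a` for some `z`. -/
def Incline.IsRegular {R : Type*} [Incline R] (a : R) : Prop :=
  ∃ z : R, a * z * a = a

namespace Incline

variable {R : Type*} [Incline R]

/-- The incline order, under which addition is the join. -/
abbrev toSemilatticeSup : SemilatticeSup R where
  le x y := x + y = y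
  sup x y := x + y
  le_refl := add_idem
  le_trans x y z hxy hyz := by rw [← hyz, ← add_assoc, hxy]
  le_antisymm x y hxy hyx := by rw [← hyx, add_comm, hxy]
  le_sup_left x y := by rw [← add_assoc, add_idem]
  le_sup_right x y := by rw [add_comm x y, ← add_assoc, add_idem]
  sup_le x y z hxz hyz := by rw [add_assoc, hyz, hxz]

theorem mul_add_eq_left (x y : R) : x * y + x = x := by
  rw [add_comm, add_absorb_mul_left]

theorem mul_add_eq_right (x y : R) : x * y + y = y := by
  rw [add_comm, add_absorb_mul_right]

theorem IsRegular.mul_self {a : R} (ha : IsRegular a) : a * a = a := by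
  obtain ⟨z, hz⟩ := ha
  calc
    a * a = (a * z + a) * a := by rw [mul_add_eq_left]
    _ = a + a * a := by rw [right_distrib, hz]
    _ = a := add_absorb_mul_left a a

theorem IsRegular.add_mul_eq {x y z : R} (hx : IsRegular x) (hxy : x + y = y)
    (hxz : x + z = z) : x + y * z = y * z := by
  have h : y * z = x + x * z + y * z := by
    calc
      y * z = (x + y) * z := by rw [hxy]
      _ = x * z + y * z := right_distrib x y z
      _ = x * (x + z) + y * z := by rw [hxz]
      _ = x + x * z + y * z := by rw [left_distrib, hx.mul_self]
  rw [h, ← add_assoc, ← add_assoc, add_idem]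

/-- A regular incline is a distributive lattice with meet given by multiplication. -/
abbrev toDistribLattice (hreg : ∀ a : R, IsRegular a) : DistribLattice R :=
  letI : Lattice R :=
    { toSemilatticeSup with
      inf := fun x y => x * y
      inf_le_left := mul_add_eq_left
      inf_le_right := mul_add_eq_right
      le_inf := fun x _ _ hxy hxz => (hreg x).add_mul_eq hxy hxz }
  DistribLattice.ofInfSupLe fun x y z => (left_distrib x y z).le

end Incline

theorem regular_incline_distribLattice {R : Type*} [Incline R] [Nonempty R]
    (hreg : ∀ a : R, Incline.IsRegular a) :
    ∃ L : DistribLattice R,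
      (∀ x y : R, L.le x y ↔ x + y = y) ∧
      (∀ x y : R, L.sup x y = x + y) ∧
      (∀ x y : R, L.inf x y = x * y) :=
  ⟨Incline.toDistribLattice hreg, fun _ _ => Iff.rfl, fun _ _ => rfl, fun _ _ => rfl⟩
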